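/- arXiv:1403.6933 — 3 statements merged into one kernel-verified Lean document; each statement's English description precedes it below -/
import Mathlib

section
/- For every integer n ≥ 1, an ascent sequence of length n avoids both of the patterns 0121 and 0132 if and only if it avoids the pattern 021; equivalently, every ascent sequence containing an occurrence of 021 contains an occurrence of 0121 or an occurrence of 0132. That is, 𝒮_n(0121,0132) = 𝒮_n(021) as sets. -/
/-- The number of ascents of a word of nonnegative integers. -/
def numAscents (w : List ℕ) : ℕ :=
  (w.zip w.tail).countP (fun p => p.1 < p.2)

/-- A word of nonnegative integers is an ascent sequence if it starts with 0 and
each subsequent entry is at most one more than the number of ascents preceding it. -/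
def IsAscentSeq (w : List ℕ) : Prop :=
  w.head? = some 0 ∧
    ∀ i (h : i < w.length), 1 ≤ i → w.get ⟨i, h⟩ ≤ numAscents (w.take i) + 1

/-- A word `π` contains the pattern `τ` if it has a subsequence order-isomorphic to `τ`. -/
def Contains (π τ : List ℕ) : Prop :=
  ∃ f : Fin τ.length → Fin π.length, StrictMono f ∧
    ∀ i j, (π.get (f i) < π.get (f j) ↔ τ.get i < τ.get j) ∧
      (π.get (f i) > π.get (f j) ↔ τ.get i > τ.get j)

/-- A word avoids a pattern if it does not contain it. -/
def Avoids (π τ : List ℕ) : Prop := ¬ Contains π τ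

/-- The set of ascent sequences of length `n` avoiding every pattern in `T`. -/
def avoiderSet (n : ℕ) (T : List (List ℕ)) : Set (List ℕ) :=
  {w : List ℕ | w.length = n ∧ IsAscentSeq w ∧ ∀ τ ∈ T, Avoids w τ}

theorem Contains.trans {π τ σ : List ℕ} (h₁ : Contains π τ) (h₂ : Contains τ σ) :
    Contains π σ := by
  obtain ⟨f, hf, hf'⟩ := h₁
  obtain ⟨g, hg, hg'⟩ := h₂
  exact ⟨f ∘ g, hf.comp hg, fun i j =>
    ⟨(hf' _ _).1.trans (hg' i j).1, (hf' _ _).2.trans (hg' i j).2⟩⟩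

theorem contains_0121_021 : Contains [0,1,2,1] [0,2,1] :=
  ⟨(![0, 2, 3] : Fin 3 → Fin 4), by unfold StrictMono; decide, by decide⟩

theorem contains_0132_021 : Contains [0,1,3,2] [0,2,1] :=
  ⟨(![0, 2, 3] : Fin 3 → Fin 4), by unfold StrictMono; decide, by decide⟩

theorem numAscents_replicate (n a : ℕ) : numAscents (List.replicate n a) = 0 := by
  simp [numAscents, List.tail_replicate, List.zip_replicate]

theorem IsAscentSeq.get_zero {w : List ℕ} (hw : IsAscentSeq w) (h : 0 < w.length) :
    w.get ⟨0, h⟩ = 0 := by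
  have := hw.1
  rw [List.head?_eq_getElem?, List.getElem?_eq_getElem h] at this
  simpa using this

/-- The first nonzero entry of an ascent sequence is `1`. -/
theorem IsAscentSeq.exists_get_eq_one {w : List ℕ} (hw : IsAscentSeq w) (j : Fin w.length)
    (hj : w.get j ≠ 0) : ∃ p : Fin w.length, p ≤ j ∧ w.get p = 1 := by
  classical
  have hex : ∃ i, ∃ h : i < w.length, w.get ⟨i, h⟩ ≠ 0 := ⟨j, j.2, hj⟩
  obtain ⟨hp, hne⟩ := Nat.find_spec hex
  have hmin : ∀ i (h : i < w.length), i < Nat.find hex → w.get ⟨i, h⟩ = 0 := fun i h hi => by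
    by_contra h0
    exact Nat.find_min hex hi ⟨h, h0⟩
  have hle : Nat.find hex ≤ j := Nat.find_min' hex ⟨j.2, hj⟩
  generalize Nat.find hex = p at hp hne hmin hle
  refine ⟨⟨p, hp⟩, hle, ?_⟩
  have htake : w.take p = List.replicate p 0 := by
    refine List.ext_getElem (by simp; omega) fun i h₁ h₂ => ?_
    have hi : i < p := by simpa using h₂
    simpa using hmin i (hi.trans hp) hi
  have hp1 : 1 ≤ p := by
    by_contra h0
    obtain rfl : p = 0 := by omega
    exact hne (hw.get_zero hp)
  have := hw.2 p hp hp1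
  rw [htake, numAscents_replicate] at this
  omega

theorem IsAscentSeq.contains_of_contains_021 {w : List ℕ} (hw : IsAscentSeq w)
    (h : Contains w [0,2,1]) : Contains w [0,1,2,1] ∨ Contains w [0,1,3,2] := by
  obtain ⟨f, hf, hf'⟩ := h
  obtain ⟨i, j, k, hij, hjk, hik', hkj'⟩ : ∃ i j k : Fin w.length, i < j ∧ j < k ∧
      w.get i < w.get k ∧ w.get k < w.get j :=
    ⟨f (0 : Fin 3), f (1 : Fin 3), f (2 : Fin 3), hf (by decide), hf (by decide),
      (hf' (0 : Fin 3) (2 : Fin 3)).1.2 (by decide),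
      (hf' (2 : Fin 3) (1 : Fin 3)).1.2 (by decide)⟩
  obtain ⟨p, hpj, hp⟩ := hw.exists_get_eq_one j (by omega)
  have hpj : p < j := lt_of_le_of_ne hpj (by rintro rfl; omega)
  have hlen : 0 < w.length := p.pos
  have h0 := hw.get_zero hlen
  have h0p : (⟨0, hlen⟩ : Fin w.length) < p := by
    refine lt_of_le_of_ne (Nat.zero_le _) ?_
    rintro rfl
    omega
  have hmono : StrictMono (![⟨0, hlen⟩, p, j, k] : Fin 4 → Fin w.length) := by
    refine Fin.strictMono_iff_lt_succ.2 fun i => ?_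
    fin_cases i
    exacts [h0p, hpj, hjk]
  generalize (⟨0, hlen⟩ : Fin w.length) = z at *
  by_cases hk : w.get k = 1
  · refine Or.inl ⟨(![z, p, j, k] : Fin 4 → Fin w.length), hmono, fun (a b : Fin 4) => ?_⟩
    fin_cases a <;> fin_cases b <;> simp at * <;> omega
  · refine Or.inr ⟨(![z, p, j, k] : Fin 4 → Fin w.length), hmono, fun (a b : Fin 4) => ?_⟩
    fin_cases a <;> fin_cases b <;> simp at * <;> omega

/-- An ascent sequence of length `n` avoids both 0121 and 0132 iff it avoids 021;
equivalently, every ascent sequence containing 021 contains 0121 or 0132. -/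
theorem avoiderSet_0121_0132_eq_021 (n : ℕ) (hn : 1 ≤ n) :
    avoiderSet n [[0,1,2,1], [0,1,3,2]] = avoiderSet n [[0,2,1]] ∧
    ∀ w : List ℕ, IsAscentSeq w → Contains w [0,2,1] →
      Contains w [0,1,2,1] ∨ Contains w [0,1,3,2] := by
  refine ⟨?_, fun w hw => hw.contains_of_contains_021⟩
  ext w
  simp only [avoiderSet, Set.mem_ofPred_eq, List.forall_mem_cons, Avoids]
  constructor
  · rintro ⟨hl, hw, h₁, h₂, h₃⟩
    exact ⟨hl, hw, fun h => (hw.contains_of_contains_021 h).elim h₁ h₂, h₃⟩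
  · rintro ⟨hl, hw, h, h₃⟩
    exact ⟨hl, hw, fun h' => h (h'.trans contains_0121_021),
      fun h' => h (h'.trans contains_0132_021), h₃⟩
end

section
/- For all integers n ≥ 1 and 0 ≤ m < n, the following four quantities are equal: the number of ascent sequences of length n with exactly m ascents avoiding {0121, 0132}, the number avoiding {0121, 1032}, the number avoiding {0122, 0132}, and the number avoiding {0122, 1032}; i.e., S_{n,m}(0121,0132) = S_{n,m}(0121,1032) = S_{n,m}(0122,0132) = S_{n,m}(0122,1032). -/
/-- The number of ascent sequences of length `n` with exactly `m` ascents avoiding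
every pattern in `T`. -/
noncomputable def avoiderCountAsc (n m : ℕ) (T : List (List ℕ)) : ℕ :=
  {w : List ℕ | w.length = n ∧ IsAscentSeq w ∧ numAscents w = m ∧ ∀ τ ∈ T, Avoids w τ}.ncard

/-! ### Words, sublists and ascents -/

theorem append_singleton_sublist_iff {α : Type*} (s u : List α) (d e : α) :
    (s ++ [d]).Sublist (u ++ [e]) ↔ (s ++ [d]).Sublist u ∨ (d = e ∧ s.Sublist u) := by
  rw [← List.reverse_sublist, ← List.reverse_sublist (l₁ := s ++ [d]),
    ← List.reverse_sublist (l₁ := s)]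
  simp only [List.reverse_append, List.reverse_singleton, List.singleton_append]
  constructor
  · intro h
    cases h with
    | cons _ h => exact Or.inl h
    | cons_cons _ h => exact Or.inr ⟨rfl, h⟩
  · rintro (h | ⟨rfl, h⟩)
    · exact h.cons _
    · exact h.cons_cons _

theorem pair_sublist_append_iff (u : List ℕ) (x y e : ℕ) :
    [x, y].Sublist (u ++ [e]) ↔ [x, y].Sublist u ∨ (y = e ∧ x ∈ u) := by
  simpa using append_singleton_sublist_iff [x] u y e

theorem triple_sublist_append_iff (u : List ℕ) (x y d e : ℕ) :
    [x, y, d].Sublist (u ++ [e]) ↔ [x, y, d].Sublist u ∨ (d = e ∧ [x, y].Sublist u) :=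
  append_singleton_sublist_iff [x, y] u d e

theorem numAscents_append (u : List ℕ) (l e : ℕ) :
    numAscents (u ++ [l] ++ [e]) = numAscents (u ++ [l]) + if l < e then 1 else 0 := by
  induction u with
  | nil => simp [numAscents, List.countP_cons]
  | cons x u ih =>
    cases u with
    | nil => simp [numAscents, List.countP_cons]; split_ifs <;> omega
    | cons y u =>
      simp only [numAscents, List.cons_append, List.tail_cons, List.zip_cons_cons,
        List.countP_cons] at ih ⊢
      omega

theorem isAscentSeq_append (u : List ℕ) (hu : u ≠ []) (e : ℕ) :
    IsAscentSeq (u ++ [e]) ↔ IsAscentSeq u ∧ e ≤ numAscents u + 1 := by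
  have hpos : 1 ≤ u.length := List.length_pos_iff.2 hu
  unfold IsAscentSeq
  rw [List.head?_append_of_ne_nil _ hu]
  constructor
  · rintro ⟨h0, h⟩
    refine ⟨⟨h0, fun i hi h1 => ?_⟩, ?_⟩
    · have := h i (by simp; omega) h1
      rw [List.take_append_of_le_length hi.le] at this
      simpa [List.getElem_append_left hi] using this
    · simpa using h u.length (by simp) hpos
  · rintro ⟨⟨h0, h⟩, he⟩
    refine ⟨h0, fun i hi h1 => ?_⟩
    rcases lt_or_ge i u.length with hlt | hge
    · rw [List.take_append_of_le_length hlt.le]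
      simpa [List.getElem_append_left hlt] using h i hlt h1
    · have : i = u.length := by simp at hi; omega
      subst this
      simpa using he

theorem isAscentSeq_singleton (e : ℕ) : IsAscentSeq [e] ↔ e = 0 := by
  simp only [IsAscentSeq, List.head?_cons, Option.some.injEq, List.length_singleton]
  constructor
  · exact fun h => h.1
  · exact fun h => ⟨h, fun i hi h1 => by omega⟩

theorem IsAscentSeq.eq_cons {w : List ℕ} (h : IsAscentSeq w) : ∃ t, w = 0 :: t := by
  cases w with
  | nil => simp [IsAscentSeq] at h
  | cons x t => exact ⟨t, by simpa [IsAscentSeq] using h.1⟩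

theorem IsAscentSeq.cons_zero_sublist {w s : List ℕ} (h : IsAscentSeq w) {x : ℕ} (hx : 0 < x)
    (hs : (x :: s).Sublist w) : (0 :: x :: s).Sublist w := by
  obtain ⟨t, rfl⟩ := h.eq_cons
  cases hs with
  | cons _ h => exact h.cons_cons _
  | cons_cons _ h => omega

theorem IsAscentSeq.of_append {u v : List ℕ} (hu : u ≠ []) (h : IsAscentSeq (u ++ v)) :
    IsAscentSeq u := by
  induction v using List.reverseRecOn with
  | nil => simpa using h
  | append_singleton v e ih =>
    rw [← List.append_assoc, isAscentSeq_append _ (by simp [hu])] at h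
    exact ih h.1

/-! ### Pattern containment through sublists -/

theorem contains_iff_sublist (w τ : List ℕ) :
    Contains w τ ↔ ∃ s : List ℕ, s.Sublist w ∧ ∃ h : s.length = τ.length,
      ∀ i j : Fin τ.length, (s[i] < s[j] ↔ τ[i] < τ[j]) := by
  constructor
  · rintro ⟨f, hf, h⟩
    refine ⟨List.ofFn fun i => w.get (f i), ?_, by simp, fun i j => by simpa using (h i j).1⟩
    rw [List.sublist_iff_exists_fin_orderEmbedding_get_eq]
    refine ⟨OrderEmbedding.ofStrictMono (fun i => f (i.cast (by simp)))
      fun i j hij => hf hij, fun i => ?_⟩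
    simp
    rfl
  · rintro ⟨s, hs, hl, h⟩
    rw [List.sublist_iff_exists_fin_orderEmbedding_get_eq] at hs
    obtain ⟨f, hf⟩ := hs
    refine ⟨fun i => f (i.cast hl.symm),
      fun i j hij => f.strictMono hij, fun i j => ?_⟩
    rw [← hf, ← hf]
    exact ⟨h i j, h j i⟩

theorem contains_iff_of_length_eq_four (w : List ℕ) (p q r t : ℕ) :
    Contains w [p, q, r, t] ↔ ∃ a b c d, [a, b, c, d].Sublist w ∧
      ∀ i j : Fin 4, (![a, b, c, d] i < ![a, b, c, d] j ↔ ![p, q, r, t] i < ![p, q, r, t] j) := by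
  rw [contains_iff_sublist]
  constructor
  · rintro ⟨s, hs, hl, h⟩
    match s, hl with
    | [a, b, c, d], _ =>
      refine ⟨a, b, c, d, hs, fun i j => ?_⟩
      have := h i j
      fin_cases i <;> fin_cases j <;> exact this
  · rintro ⟨a, b, c, d, hs, h⟩
    refine ⟨_, hs, rfl, fun i j => ?_⟩
    have := h i j
    fin_cases i <;> fin_cases j <;> exact this

theorem contains_0121_iff (w : List ℕ) : Contains w [0, 1, 2, 1] ↔
    ∃ a b c, [a, b, c, b].Sublist w ∧ a < b ∧ b < c := by
  rw [contains_iff_of_length_eq_four]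
  simp only [Fin.forall_fin_succ, IsEmpty.forall_iff]
  constructor
  · rintro ⟨a, b, c, d, hs, h⟩
    simp at h
    obtain rfl : d = b := by omega
    exact ⟨a, d, c, hs, by omega, by omega⟩
  · rintro ⟨a, b, c, hs, h1, h2⟩
    refine ⟨a, b, c, b, hs, ?_⟩
    simp
    omega

theorem contains_0122_iff (w : List ℕ) : Contains w [0, 1, 2, 2] ↔
    ∃ a b c, [a, b, c, c].Sublist w ∧ a < b ∧ b < c := by
  rw [contains_iff_of_length_eq_four]
  simp only [Fin.forall_fin_succ, IsEmpty.forall_iff]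
  constructor
  · rintro ⟨a, b, c, d, hs, h⟩
    simp at h
    obtain rfl : d = c := by omega
    exact ⟨a, b, d, hs, by omega, by omega⟩
  · rintro ⟨a, b, c, hs, h1, h2⟩
    refine ⟨a, b, c, c, hs, ?_⟩
    simp
    omega

theorem contains_0132_iff (w : List ℕ) : Contains w [0, 1, 3, 2] ↔
    ∃ a b c d, [a, b, d, c].Sublist w ∧ a < b ∧ b < c ∧ c < d := by
  rw [contains_iff_of_length_eq_four]
  simp only [Fin.forall_fin_succ, IsEmpty.forall_iff]
  constructor
  · rintro ⟨a, b, c, d, hs, h⟩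
    simp at h
    exact ⟨a, b, d, c, hs, by omega, by omega, by omega⟩
  · rintro ⟨a, b, c, d, hs, h1, h2, h3⟩
    refine ⟨a, b, d, c, hs, ?_⟩
    simp
    omega

theorem contains_1032_iff (w : List ℕ) : Contains w [1, 0, 3, 2] ↔
    ∃ a b c d, [b, a, d, c].Sublist w ∧ a < b ∧ b < c ∧ c < d := by
  rw [contains_iff_of_length_eq_four]
  simp only [Fin.forall_fin_succ, IsEmpty.forall_iff]
  constructor
  · rintro ⟨a, b, c, d, hs, h⟩
    simp at h
    exact ⟨b, a, d, c, hs, by omega, by omega, by omega⟩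
  · rintro ⟨a, b, c, d, hs, h1, h2, h3⟩
    refine ⟨b, a, d, c, hs, ?_⟩
    simp
    omega

/-! ### Interchanging 0132 and 1032 -/

/-- An ascent sequence in which no 0 follows a 1 is a restricted growth function, unless its
nonzero letters contain both 010 and 011, with the same values. -/
theorem IsAscentSeq.exists_or_restrictedGrowth {u : List ℕ} (hu : IsAscentSeq u)
    (h10 : ¬ [1, 0].Sublist u) :
    (∃ x y, 0 < x ∧ x < y ∧ [x, y, x].Sublist u ∧ [x, y, y].Sublist u) ∨
      ∃ v l, u = v ++ [l] ∧ (l = 0 → numAscents u = 0) ∧ (∀ x ∈ u, x ≤ numAscents u) ∧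
        (∀ x ≤ numAscents u, x ∈ u) ∧
        ∀ x y, x < y → y ≤ numAscents u → [x, y].Sublist u := by
  induction u using List.reverseRecOn with
  | nil => simp [IsAscentSeq] at hu
  | append_singleton u e ih =>
    rcases eq_or_ne u [] with rfl | hne
    · obtain rfl : e = 0 := by simpa [isAscentSeq_singleton] using hu
      right
      refine ⟨[], 0, rfl, ?_⟩
      simp [numAscents]
      omega
    rw [isAscentSeq_append u hne] at hu
    rcases ih hu.1 (fun h => h10 (h.trans (List.sublist_append_left _ _))) with
      ⟨x, y, hx, hy, h1, h2⟩ | ⟨v, l, rfl, hl, hle, hmem, hpair⟩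
    · exact Or.inl ⟨x, y, hx, hy, h1.trans (List.sublist_append_left _ _),
        h2.trans (List.sublist_append_left _ _)⟩
    obtain ⟨hu, he⟩ := hu
    have hlM := hle l (by simp)
    have hasc := numAscents_append v l e
    set M := numAscents (v ++ [l]) with hM
    rw [pair_sublist_append_iff] at h10
    push Not at h10
    rcases Nat.lt_or_ge M e with hMe | heM
    · obtain rfl : e = M + 1 := by omega
      rw [if_pos (by omega)] at hasc
      right
      refine ⟨_, _, rfl, by omega, ?_, ?_, ?_⟩
      · intro x hx
        rw [List.mem_append, List.mem_singleton] at hx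
        rcases hx with hx | hx
        · have := hle x hx; omega
        · omega
      · intro x hx
        rw [List.mem_append, List.mem_singleton]
        rcases Nat.lt_or_ge M x with h | h
        · right; omega
        · exact Or.inl (hmem x h)
      · intro x y hxy hy
        rw [pair_sublist_append_iff]
        rcases Nat.lt_or_ge M y with h | h
        · exact Or.inr ⟨by omega, hmem x (by omega)⟩
        · exact Or.inl (hpair x y hxy h)
    · by_cases hle' : l < e
      · left
        have hl0 : 0 < l := by
          rcases Nat.eq_zero_or_pos l with h | h
          · have := hl h; omega
          · exact h
        have hp := hpair l e hle' heM
        refine ⟨l, e, hl0, hle', ?_, ?_⟩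
        · rw [triple_sublist_append_iff, triple_sublist_append_iff]
          rw [pair_sublist_append_iff] at hp
          rcases hp with hp | ⟨h, -⟩
          · exact Or.inl (Or.inr ⟨rfl, hp⟩)
          · omega
        · rw [triple_sublist_append_iff]
          exact Or.inr ⟨rfl, hp⟩
      · rw [if_neg hle', Nat.add_zero] at hasc
        right
        refine ⟨_, _, rfl, ?_, ?_, ?_, ?_⟩
        · intro h0
          by_contra h
          exact h10.2 h0.symm (hmem 1 (by omega))
        · intro x hx
          rw [List.mem_append, List.mem_singleton] at hx
          rcases hx with hx | rfl
          · rw [hasc]; exact hle x hx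
          · omega
        · intro x hx
          exact List.mem_append_left _ (hmem x (by omega))
        · intro x y hxy hy
          rw [pair_sublist_append_iff]
          exact Or.inl (hpair x y hxy (by omega))

theorem IsAscentSeq.contains_0132_of_contains_1032 {w : List ℕ} (hw : IsAscentSeq w)
    (h : Contains w [1, 0, 3, 2]) : Contains w [0, 1, 3, 2] := by
  rw [contains_1032_iff] at h
  rw [contains_0132_iff]
  obtain ⟨a, b, c, d, hs, hab, hbc, hcd⟩ := h
  refine ⟨0, b, c, d, hw.cons_zero_sublist (by omega) (List.Sublist.trans ?_ hs), by omega,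
    hbc, hcd⟩
  exact (List.sublist_cons_self _ _).cons_cons _

theorem IsAscentSeq.contains_of_contains_0132 {w : List ℕ} (hw : IsAscentSeq w)
    (h : Contains w [0, 1, 3, 2]) (h' : ¬ Contains w [1, 0, 3, 2]) :
    Contains w [0, 1, 2, 1] ∧ Contains w [0, 1, 2, 2] := by
  suffices ∃ x y x' y', 0 < x ∧ x < y ∧ 0 < x' ∧ x' < y' ∧
      [x, y, x].Sublist w ∧ [x', y', y'].Sublist w by
    obtain ⟨x, y, x', y', hx, hxy, hx', hxy', h1, h2⟩ := this
    rw [contains_0121_iff, contains_0122_iff]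
    exact ⟨⟨0, x, y, hw.cons_zero_sublist hx h1, hx, hxy⟩,
      ⟨0, x', y', hw.cons_zero_sublist hx' h2, hx', hxy'⟩⟩
  rw [contains_0132_iff] at h
  rw [contains_1032_iff] at h'
  obtain ⟨a, b, c, d, hs, hab, hbc, hcd⟩ := h
  have hs' : [d, c].Sublist w :=
    List.Sublist.trans ((List.sublist_cons_self _ _).trans (List.sublist_cons_self _ _)) hs
  rw [show [d, c] = [d] ++ [c] from rfl, List.append_sublist_iff] at hs'
  obtain ⟨u, R, rfl, hd, hc⟩ := hs'
  rw [List.singleton_sublist] at hd hc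
  obtain ⟨P, P', rfl⟩ := List.append_of_mem hd
  replace hc : [c].Sublist (P' ++ R) :=
    List.singleton_sublist.2 (List.mem_append_right _ hc)
  have hsplit : P ++ d :: P' ++ R = (P ++ [d]) ++ (P' ++ R) := by simp
  rw [hsplit] at hw h' ⊢
  have hu : IsAscentSeq (P ++ [d]) := hw.of_append (by simp)
  have h10 : ¬ [1, 0].Sublist (P ++ [d]) := by
    rw [pair_sublist_append_iff]
    rintro (h | ⟨h, -⟩)
    · exact h' ⟨0, 1, c, d, (h.append (List.Sublist.refl [d])).append hc, by omega, by omega, hcd⟩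
    · omega
  rcases hu.exists_or_restrictedGrowth h10 with
    ⟨x, y, hx, hxy, h1, h2⟩ | ⟨-, -, -, -, hle, -, hpair⟩
  · exact ⟨x, y, x, y, hx, hxy, hx, hxy, h1.trans (List.sublist_append_left _ _),
      h2.trans (List.sublist_append_left _ _)⟩
  · have hdM := hle d (by simp)
    exact ⟨c, d, 1, c, by omega, hcd, by omega, by omega,
      (hpair c d hcd hdM).append hc, (hpair 1 c (by omega) (by omega)).append hc⟩

/-! ### The common form of the avoidance conditions -/

/-- The letter `d` may follow `w` without completing a forbidden triple of nonzero letters. For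
`ε = 0` the forbidden patterns are 010 and 021, for `ε = 1` they are 011 and 021. -/
def Allowed (ε : ℕ) (w : List ℕ) (d : ℕ) : Prop :=
  ∀ x y, [x, y].Sublist w → 0 < x → x < y → ¬ (x + ε ≤ d ∧ d < y + ε)

/-- The nonzero letters of `w` avoid 010 and 021 (for `ε = 0`), or 011 and 021 (for `ε = 1`). -/
def NonzeroAvoids (ε : ℕ) (w : List ℕ) : Prop :=
  ∀ x y d, [x, y, d].Sublist w → 0 < x → x < y → ¬ (x + ε ≤ d ∧ d < y + ε)

theorem nonzeroAvoids_append (ε : ℕ) (w : List ℕ) (c : ℕ) :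
    NonzeroAvoids ε (w ++ [c]) ↔ NonzeroAvoids ε w ∧ Allowed ε w c := by
  simp only [NonzeroAvoids, Allowed, triple_sublist_append_iff]
  constructor
  · exact fun h => ⟨fun x y d hs => h x y d (Or.inl hs),
      fun x y hs => h x y c (Or.inr ⟨rfl, hs⟩)⟩
  · rintro ⟨h1, h2⟩ x y d (hs | ⟨rfl, hs⟩)
    · exact h1 x y d hs
    · exact h2 x y hs

theorem allowed_append (ε : ℕ) (w : List ℕ) (c d : ℕ) :
    Allowed ε (w ++ [c]) d ↔
      Allowed ε w d ∧ ∀ x ∈ w, 0 < x → x < c → ¬ (x + ε ≤ d ∧ d < c + ε) := by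
  simp only [Allowed, pair_sublist_append_iff]
  constructor
  · exact fun h => ⟨fun x y hs => h x y (Or.inl hs),
      fun x hx => h x c (Or.inr ⟨rfl, hx⟩)⟩
  · rintro ⟨h1, h2⟩ x y (hs | ⟨rfl, hs⟩)
    · exact h1 x y hs
    · exact h2 x hs

theorem IsAscentSeq.avoids_0121_0132_iff {w : List ℕ} (hw : IsAscentSeq w) :
    (Avoids w [0, 1, 2, 1] ∧ Avoids w [0, 1, 3, 2]) ↔ NonzeroAvoids 0 w := by
  simp only [Avoids, contains_0121_iff, contains_0132_iff, NonzeroAvoids]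
  constructor
  · rintro ⟨h1, h2⟩ x y d hs hx hxy ⟨hd, hd'⟩
    have hs' := hw.cons_zero_sublist hx hs
    rcases Nat.eq_or_lt_of_le hd with h | h
    · obtain rfl : x = d := by omega
      exact h1 ⟨0, x, y, hs', hx, hxy⟩
    · exact h2 ⟨0, x, d, y, hs', hx, by omega, by omega⟩
  · refine fun h => ⟨?_, ?_⟩
    · rintro ⟨a, b, c, hs, hab, hbc⟩
      exact h b c b ((List.sublist_cons_self _ _).trans hs) (by omega) hbc (by omega)
    · rintro ⟨a, b, c, d, hs, hab, hbc, hcd⟩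
      exact h b d c ((List.sublist_cons_self _ _).trans hs) (by omega) (by omega) (by omega)

theorem IsAscentSeq.avoids_0122_0132_iff {w : List ℕ} (hw : IsAscentSeq w) :
    (Avoids w [0, 1, 2, 2] ∧ Avoids w [0, 1, 3, 2]) ↔ NonzeroAvoids 1 w := by
  simp only [Avoids, contains_0122_iff, contains_0132_iff, NonzeroAvoids]
  constructor
  · rintro ⟨h1, h2⟩ x y d hs hx hxy ⟨hd, hd'⟩
    have hs' := hw.cons_zero_sublist hx hs
    rcases Nat.eq_or_lt_of_le (Nat.lt_succ_iff.1 hd') with h | h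
    · obtain rfl : d = y := by omega
      exact h1 ⟨0, x, d, hs', hx, hxy⟩
    · exact h2 ⟨0, x, d, y, hs', hx, by omega, by omega⟩
  · refine fun h => ⟨?_, ?_⟩
    · rintro ⟨a, b, c, hs, hab, hbc⟩
      exact h b c c ((List.sublist_cons_self _ _).trans hs) (by omega) hbc (by omega)
    · rintro ⟨a, b, c, d, hs, hab, hbc, hcd⟩
      exact h b d c ((List.sublist_cons_self _ _).trans hs) (by omega) (by omega) (by omega)

/-! ### The generating tree -/

/-- A word together with the data governing its one-letter extensions: whether it ends in 0, the
allowed positive letters below (`low`) and not below (`high`) its smallest positive letter, in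
increasing order, and its number of ascents. -/
structure TreeState where
  word : List ℕ
  endsZero : Bool
  low : List ℕ
  high : List ℕ
  asc : ℕ

/-- Appends 0 (for code 0) or the allowed positive letter of index `i` (for code `i + 1`). -/
def TreeState.step (ε : ℕ) (s : TreeState) : ℕ → TreeState
  | 0 => { s with word := s.word ++ [0], endsZero := true }
  | i + 1 =>
    let isAsc := s.endsZero || decide (s.low.length < i)
    { word := s.word ++ [(s.low ++ s.high).getD i 0]
      endsZero := false
      low := s.low.take i
      high := s.low.drop i ++ s.high.take ε ++ s.high.drop (i - s.low.length + ε) ++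
        if isAsc then [s.asc + 2] else []
      asc := if isAsc then s.asc + 1 else s.asc }

/-- The node of the generating tree reached by a list of codes, latest code first. -/
def treeNode (ε : ℕ) : List ℕ → TreeState
  | [] => ⟨[0], true, [1], [], 0⟩
  | r :: rs => (treeNode ε rs).step ε r

/-- Every code in the list selects an existing child. -/
def ValidCode (ε : ℕ) : List ℕ → Prop
  | [] => True
  | r :: rs => ValidCode ε rs ∧
      r ≤ (treeNode ε rs).low.length + (treeNode ε rs).high.length

/-- The meaning of the fields of a state, with the facts that determine its children. -/
structure TreeState.Faithful (ε : ℕ) (s : TreeState) : Prop where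
  sorted : (s.low ++ s.high).Pairwise (· < ·)
  mem_iff : ∀ d, d ∈ s.low ++ s.high ↔ 0 < d ∧ d ≤ s.asc + 1 ∧ Allowed ε s.word d
  asc_eq : s.asc = numAscents s.word
  le_asc : ∀ x ∈ s.word, x ≤ s.asc + 1
  low_lt : ∀ d ∈ s.low, ∀ x ∈ s.word, 0 < x → d < x
  le_high : ∀ d ∈ s.high, ∃ x ∈ s.word, 0 < x ∧ x ≤ d
  head_le : ε = 1 → ∀ h t, s.high = h :: t → ∀ x ∈ s.word, 0 < x → h ≤ x
  last : ∃ u l, s.word = u ++ [l] ∧ (s.endsZero = true → l = 0) ∧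
    (s.endsZero = false → 0 < l ∧ ∃ h t, s.high = h :: t ∧ h ≤ l ∧ ∀ d ∈ t, l < d)
  isAscentSeq : IsAscentSeq s.word
  nonzeroAvoids : NonzeroAvoids ε s.word

theorem TreeState.Faithful.append {ε : ℕ} (hε : ε ≤ 1) {s : TreeState} (hs : s.Faithful ε)
    {c h : ℕ} {b : Bool} {low' t : List ℕ} (hc : c ∈ s.low ++ s.high)
    (hb : ∀ u l, s.word = u ++ [l] → (b = true ↔ l < c))
    (hsorted : (low' ++ h :: t).Pairwise (· < ·))
    (hmem : ∀ d, d ∈ low' ++ h :: t ↔ d ∈ s.low ++ s.high ∧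
      ∀ x ∈ s.word, 0 < x → x < c → ¬ (x + ε ≤ d ∧ d < c + ε))
    (hlow : ∀ d ∈ low', d < c ∧ ∀ x ∈ s.word, 0 < x → d < x)
    (hhigh : ∃ x ∈ s.word ++ [c], 0 < x ∧ x ≤ h)
    (hhc : h ≤ c) (htc : ∀ d ∈ t, c < d)
    (hhead : ε = 1 → ∀ x ∈ s.word, 0 < x → h ≤ x) :
    TreeState.Faithful ε ⟨s.word ++ [c], false, low',
      (h :: t) ++ (if b then [s.asc + 2] else []), if b then s.asc + 1 else s.asc⟩ := by
  obtain ⟨hc0, hca, hcallow⟩ := (hs.mem_iff c).1 hc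
  have hle : ∀ d ∈ low' ++ h :: t, d < s.asc + 2 := fun d hd => by
    have := ((hs.mem_iff d).1 ((hmem d).1 hd).1).2.1
    omega
  have hword : ∀ x ∈ s.word ++ [c], x ≤ s.asc + 1 := fun x hx => by
    rw [List.mem_append, List.mem_singleton] at hx
    rcases hx with hx | rfl
    · exact hs.le_asc x hx
    · exact hca
  have hbase : ∀ d, d ∈ low' ++ h :: t ↔ 0 < d ∧ d ≤ s.asc + 1 ∧ Allowed ε (s.word ++ [c]) d := by
    intro d
    rw [hmem, hs.mem_iff, allowed_append]
    tauto
  obtain ⟨u, l, hul, hz, hnz⟩ := hs.last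
  have hne : s.word ≠ [] := by simp [hul]
  obtain ⟨x₀, hx₀, hx₀', hx₀h⟩ := hhigh
  constructor
  · simp only
    cases b
    · simpa using hsorted
    · rw [← List.append_assoc, if_pos rfl, List.pairwise_append]
      exact ⟨hsorted, List.pairwise_singleton _ _, fun d hd e he => by
        rw [List.mem_singleton.1 he]; exact hle d hd⟩
  · intro d
    simp only
    cases b
    · simpa using hbase d
    · rw [← List.append_assoc, List.mem_append, hbase, if_pos rfl, if_pos rfl,
        List.mem_singleton]
      constructor
      · rintro (⟨h1, h2, h3⟩ | rfl)
        · exact ⟨h1, by omega, h3⟩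
        · refine ⟨by omega, by omega, fun x y hxy _ _ hd => ?_⟩
          have := hword y (hxy.subset (by simp))
          omega
      · rintro ⟨h1, h2, h3⟩
        rcases Nat.eq_or_lt_of_le h2 with h | h
        · exact Or.inr h
        · exact Or.inl ⟨h1, by omega, h3⟩
  · have := hb u l hul
    simp only
    rw [hul, numAscents_append, ← hul, ← hs.asc_eq]
    by_cases h : l < c
    · simp [h, this.2 h]
    · simp [h, this]
  · intro x hx
    have := hword x hx
    simp only
    split_ifs <;> omega
  · intro d hd x hx
    have hx' : x ∈ s.word ++ [c] := hx
    rw [List.mem_append, List.mem_singleton] at hx'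
    rcases hx' with hx' | rfl
    · exact (hlow d hd).2 x hx'
    · exact fun _ => (hlow d hd).1
  · intro d hd
    refine ⟨x₀, hx₀, hx₀', hx₀h.trans ?_⟩
    have hd' : d = h ∨ d ∈ t ∨ d ∈ (if b then [s.asc + 2] else []) := by simpa [or_assoc] using hd
    rcases hd' with rfl | hd' | hd'
    · exact le_rfl
    · exact hhc.trans (htc d hd').le
    · have := hle h (by simp)
      cases b
      · simp at hd'
      · simp at hd'; omega
  · intro h1 h' t' heq x hx hx0
    obtain ⟨rfl, -⟩ : h = h' ∧ _ := by simpa using heq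
    have hx' : x ∈ s.word ++ [c] := hx
    rw [List.mem_append, List.mem_singleton] at hx'
    rcases hx' with hx' | rfl
    · exact hhead h1 x hx' hx0
    · exact hhc
  · refine ⟨_, _, rfl, by simp, fun _ => ⟨hc0, h, _, rfl, hhc, fun d hd => ?_⟩⟩
    rcases List.mem_append.1 hd with hd | hd
    · exact htc d hd
    · cases b
      · simp at hd
      · simp at hd; omega
  · exact (isAscentSeq_append _ hne _).2 ⟨hs.isAscentSeq, by rw [← hs.asc_eq]; exact hca⟩
  · exact (nonzeroAvoids_append _ _ _).2 ⟨hs.nonzeroAvoids, hcallow⟩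

theorem TreeState.Faithful.step_zero {ε : ℕ} {s : TreeState} (hs : s.Faithful ε) :
    (s.step ε 0).Faithful ε := by
  obtain ⟨u, l, hul, -, -⟩ := hs.last
  have hne : s.word ≠ [] := by simp [hul]
  have hmem : ∀ x, x ∈ s.word ++ [0] → 0 < x → x ∈ s.word := fun x hx h0 => by
    rw [List.mem_append, List.mem_singleton] at hx
    rcases hx with hx | rfl
    · exact hx
    · omega
  constructor
  · exact hs.sorted
  · intro d
    simp only [TreeState.step, allowed_append]
    rw [hs.mem_iff]
    simp
  · simp only [TreeState.step]
    rw [hul, numAscents_append, ← hul, hs.asc_eq]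
    simp
  · intro x hx
    rcases Nat.eq_zero_or_pos x with rfl | h
    · exact Nat.zero_le _
    · exact hs.le_asc x (hmem x hx h)
  · exact fun d hd x hx h0 => hs.low_lt d hd x (hmem x hx h0) h0
  · intro d hd
    obtain ⟨x, hx, h⟩ := hs.le_high d hd
    exact ⟨x, List.mem_append_left _ hx, h⟩
  · exact fun h1 h t ht x hx h0 => hs.head_le h1 h t ht x (hmem x hx h0) h0
  · exact ⟨_, _, rfl, fun _ => rfl, by simp [TreeState.step]⟩
  · exact (isAscentSeq_append _ hne _).2 ⟨hs.isAscentSeq, Nat.zero_le _⟩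
  · exact (nonzeroAvoids_append _ _ _).2 ⟨hs.nonzeroAvoids, fun x y _ _ _ h => by omega⟩

theorem TreeState.Faithful.step_succ {ε : ℕ} (hε : ε ≤ 1) {s : TreeState} (hs : s.Faithful ε)
    {i : ℕ} (hi : i < s.low.length + s.high.length) : (s.step ε (i + 1)).Faithful ε := by
  have hsorted := hs.sorted
  have hpos : ∀ d ∈ s.low ++ s.high, 0 < d := fun d hd => ((hs.mem_iff d).1 hd).1
  have hmem_high : ∀ d ∈ s.high, d ∈ s.low ++ s.high := fun d hd => List.mem_append_right _ hd
  have key : ∀ c h low' t, (s.low ++ s.high).getD i 0 = c → s.low.take i = low' →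
      s.low.drop i ++ s.high.take ε ++ s.high.drop (i - s.low.length + ε) = h :: t →
      TreeState.Faithful ε ⟨s.word ++ [c], false, low',
        (h :: t) ++ (if s.endsZero || decide (s.low.length < i) then [s.asc + 2] else []),
        if s.endsZero || decide (s.low.length < i) then s.asc + 1 else s.asc⟩ →
      (s.step ε (i + 1)).Faithful ε := by
    rintro c h low' t rfl rfl h3 h4
    simp only [TreeState.step, h3]
    exact h4
  rcases lt_or_ge i s.low.length with hlt | hge
  · obtain ⟨A, c, B, hAB, rfl⟩ : ∃ A c B, s.low = A ++ c :: B ∧ A.length = i :=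
      ⟨s.low.take i, s.low[i], s.low.drop (i + 1), by simp, by simp; omega⟩
    have hcl : c ∈ s.low := by simp [hAB]
    have hlen : A.length - s.low.length = 0 := by omega
    have hcx := hs.low_lt c hcl
    have hc0 := hpos c (List.mem_append_left _ hcl)
    refine key c c A (B ++ s.high) (by simp [hAB]) (by simp [hAB]) ?_ ?_
    · rw [hlen]
      simp [hAB]
    rw [hAB] at hsorted
    simp only [List.append_assoc, List.cons_append] at hsorted
    have hsorted' := hsorted
    rw [List.pairwise_append, List.pairwise_cons] at hsorted'
    obtain ⟨-, ⟨hct, -⟩, hAc⟩ := hsorted'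
    refine hs.append hε (by simp [hAB]) ?_ hsorted ?_ ?_ ⟨c, by simp, hc0, le_rfl⟩ le_rfl hct
      (fun _ x hx h0 => (hcx x hx h0).le)
    · intro u l hul
      obtain ⟨u', l', hul', hz, hnz⟩ := hs.last
      obtain ⟨rfl, rfl⟩ : u = u' ∧ l = l' := by simpa [hul'] using hul.symm.trans hul'
      have hdec : ¬ s.low.length < A.length := by omega
      cases he : s.endsZero
      · obtain ⟨-, h, t, hht, hhl, -⟩ := hnz he
        have := hct h (by simp [hht])
        simp [hdec]
        omega
      · have := hz he
        simp
        omega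
    · intro d
      rw [hAB]
      simp only [List.append_assoc, List.cons_append]
      refine ⟨fun hd => ⟨hd, fun x hx h0 hxc => ?_⟩, fun h => h.1⟩
      have := hcx x hx h0
      omega
    · intro d hd
      exact ⟨hAc d hd c (by simp), hs.low_lt d (by simp [hAB, hd])⟩
  · obtain ⟨j, rfl⟩ := Nat.exists_eq_add_of_le hge
    have hj : j < s.high.length := by omega
    have hlow := hs.low_lt
    rw [List.pairwise_append] at hsorted
    obtain ⟨hsl, hsh, hslh⟩ := hsorted
    have htake : s.low.take (s.low.length + j) = s.low := List.take_of_length_le (by omega)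
    have hdrop : s.low.drop (s.low.length + j) = [] := List.drop_of_length_le (by omega)
    rcases j with _ | j
    · obtain ⟨c, B, hB⟩ : ∃ c B, s.high = c :: B := List.exists_cons_of_length_pos hj
      rw [hB, List.pairwise_cons] at hsh
      have hc0 := hpos c (hmem_high c (by simp [hB]))
      refine key c c s.low B (by simp [hB]) htake ?_ ?_
      · rw [hdrop, show s.low.length + 0 - s.low.length + ε = ε by omega]
        simp [hB]
      refine hs.append hε (hmem_high c (by simp [hB])) ?_ (by rw [← hB]; exact hs.sorted) ?_ ?_
        ⟨c, by simp, hc0, le_rfl⟩ le_rfl hsh.1 (fun h1 => hs.head_le h1 c B hB)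
      · intro u l hul
        obtain ⟨u', l', hul', hz, hnz⟩ := hs.last
        obtain ⟨rfl, rfl⟩ : u = u' ∧ l = l' := by simpa [hul'] using hul.symm.trans hul'
        cases he : s.endsZero
        · obtain ⟨-, h, t, hht, hhl, -⟩ := hnz he
          obtain ⟨rfl, rfl⟩ : c = h ∧ B = t := by simpa [hB] using hht
          simp
          omega
        · have := hz he
          simp
          omega
      · intro d
        rw [← hB]
        refine ⟨fun hd => ⟨hd, fun x hx h0 hxc hxd => ?_⟩, fun h => h.1⟩
        rcases List.mem_append.1 hd with hd | hd
        · have := hlow d hd x hx h0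
          omega
        · rw [hB, List.mem_cons] at hd
          rcases hd with rfl | hd
          · have := hs.head_le (by omega) d B hB x hx h0
            omega
          · have := hsh.1 d hd
            omega
      · exact fun d hd => ⟨hslh d hd c (by simp [hB]), hlow d hd⟩
    · obtain ⟨h, A, c, B, hAB, rfl⟩ : ∃ h A c B, s.high = h :: (A ++ c :: B) ∧ A.length = j := by
        obtain ⟨h, T, hT⟩ : ∃ h T, s.high = h :: T := List.exists_cons_of_length_pos (by omega)
        have hj' : j < T.length := by simpa [hT] using hj
        exact ⟨h, T.take j, T[j], T.drop (j + 1), by simp [hT], by simp; omega⟩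
      have hsh' := hsh
      rw [hAB, List.pairwise_cons, List.pairwise_append, List.pairwise_cons] at hsh'
      obtain ⟨hh, -, ⟨hcB, -⟩, hA⟩ := hsh'
      have hc_mem : c ∈ s.high := by simp [hAB]
      have hhc : h < c := hh c (by simp)
      have hc0 := hpos c (hmem_high c hc_mem)
      have hh0 := hpos h (hmem_high h (by simp [hAB]))
      obtain ⟨x₀, hx₀, hx₀', hx₀h⟩ := hs.le_high h (by simp [hAB])
      have hsub : ∀ g, g = h ∨ g = c → (g :: B).Sublist s.high := by
        rintro g (rfl | rfl)
        · rw [hAB]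
          exact ((List.sublist_cons_self _ _).trans (List.sublist_append_right _ _)).cons_cons _
        · rw [hAB]
          exact (List.sublist_append_right _ _).cons _
      have hb : ∀ u l, s.word = u ++ [l] →
          ((s.endsZero || decide (s.low.length < s.low.length + (A.length + 1))) = true ↔ l < c) := by
        intro u l hul
        obtain ⟨u', l', hul', hz, hnz⟩ := hs.last
        obtain ⟨rfl, rfl⟩ : u = u' ∧ l = l' := by simpa [hul'] using hul.symm.trans hul'
        cases he : s.endsZero
        · obtain ⟨-, h, t, hht, hhl, ht⟩ := hnz he
          rw [hAB, List.cons.injEq] at hht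
          have := ht c (by simp [← hht.2])
          simpa using this
        · have := hz he
          simp
          omega
      have hget : (s.low ++ s.high).getD (s.low.length + (A.length + 1)) 0 = c := by
        simp [hAB]
      have hsort : ∀ g, g = h ∨ g = c → (s.low ++ g :: B).Pairwise (· < ·) := fun g hg =>
        hs.sorted.sublist ((List.Sublist.refl _).append (hsub g hg))
      have hlow' : ∀ d ∈ s.low, d < c ∧ ∀ x ∈ s.word, 0 < x → d < x :=
        fun d hd => ⟨hslh d hd c hc_mem, hlow d hd⟩
      obtain rfl | rfl : ε = 0 ∨ ε = 1 := by omega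
      · refine key c c s.low B hget htake ?_ ?_
        · rw [hdrop, show s.low.length + (A.length + 1) - s.low.length + 0 = A.length + 1 by omega]
          simp [hAB]
        refine hs.append hε (hmem_high c hc_mem) hb (hsort c (Or.inr rfl)) ?_ hlow'
          ⟨c, by simp, hc0, le_rfl⟩ le_rfl hcB (by simp)
        intro d
        simp only [List.mem_append, hAB, List.mem_cons]
        constructor
        · rintro (hd | rfl | hd)
          · refine ⟨Or.inl hd, fun x hx h0 _ hxd => ?_⟩
            have := hlow d hd x hx h0
            omega
          · exact ⟨by tauto, fun x hx h0 _ hxd => by omega⟩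
          · refine ⟨by tauto, fun x hx h0 _ hxd => ?_⟩
            have := hcB d hd
            omega
        · rintro ⟨hd | rfl | hd | rfl | hd, hk⟩
          · exact Or.inl hd
          · exact absurd ⟨hx₀h, hhc⟩ (hk x₀ hx₀ hx₀' (by omega))
          · have h1 := hA d hd c (by simp)
            have h2 := hh d (by simp [hd])
            exact absurd ⟨by omega, h1⟩ (hk x₀ hx₀ hx₀' (by omega))
          · tauto
          · tauto
      · have hhead := hs.head_le rfl h _ hAB
        refine key c h s.low B hget htake ?_ ?_
        · rw [hdrop, show s.low.length + (A.length + 1) - s.low.length + 1 = A.length + 2 by omega]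
          simp [hAB, ← List.drop_drop]
        refine hs.append hε (hmem_high c hc_mem) hb (hsort h (Or.inl rfl)) ?_ hlow'
          ⟨x₀, by simp [hx₀], hx₀', hx₀h⟩ hhc.le hcB (fun _ => hhead)
        intro d
        simp only [List.mem_append, hAB, List.mem_cons]
        constructor
        · rintro (hd | rfl | hd)
          · refine ⟨Or.inl hd, fun x hx h0 _ hxd => ?_⟩
            have := hlow d hd x hx h0
            omega
          · refine ⟨by tauto, fun x hx h0 _ hxd => ?_⟩
            have := hhead x hx h0
            omega
          · refine ⟨by tauto, fun x hx h0 _ hxd => ?_⟩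
            have := hcB d hd
            omega
        · rintro ⟨hd | rfl | hd | rfl | hd, hk⟩
          · exact Or.inl hd
          · tauto
          · have h1 := hA d hd c (by simp)
            have h2 := hh d (by simp [hd])
            exact absurd ⟨by omega, by omega⟩ (hk x₀ hx₀ hx₀' (by omega))
          · exact absurd ⟨by omega, by omega⟩ (hk x₀ hx₀ hx₀' (by omega))
          · tauto

theorem treeNode_faithful {ε : ℕ} (hε : ε ≤ 1) {rs : List ℕ} (h : ValidCode ε rs) :
    (treeNode ε rs).Faithful ε := by
  induction rs with
  | nil =>
    constructor
    · simp [treeNode]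
    · intro d
      have hallow : Allowed ε [0] d := fun x y hs => by simpa using hs.length_le
      simp [treeNode, hallow]
      omega
    · simp [treeNode, numAscents]
    · simp [treeNode]
    · simp [treeNode]
    · simp [treeNode]
    · simp [treeNode]
    · exact ⟨[], 0, by simp [treeNode]⟩
    · simp [treeNode, isAscentSeq_singleton]
    · exact fun x y d hs => by simpa [treeNode] using hs.length_le
  | cons r rs ih =>
    obtain ⟨h, hr⟩ := h
    cases r with
    | zero => exact (ih h).step_zero
    | succ i => exact (ih h).step_succ hε (by omega)

/-! ### Counting through codes -/

theorem TreeState.step_word (ε : ℕ) (s : TreeState) (r : ℕ) :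
    (s.step ε r).word = s.word ++ [(0 :: (s.low ++ s.high)).getD r 0] := by
  cases r <;> simp [TreeState.step]

theorem length_treeNode_word (ε : ℕ) (rs : List ℕ) :
    (treeNode ε rs).word.length = rs.length + 1 := by
  induction rs with
  | nil => rfl
  | cons r rs ih => simp [treeNode, TreeState.step_word, ih]

theorem treeNode_word_injOn {ε : ℕ} (hε : ε ≤ 1) :
    Set.InjOn (fun rs => (treeNode ε rs).word) {rs | ValidCode ε rs} := by
  intro rs hrs rs' hrs' heq
  induction rs generalizing rs' with
  | nil =>
    have := congrArg List.length heq
    simp only [length_treeNode_word] at this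
    exact (List.length_eq_zero_iff.1 (by simpa using this.symm)).symm
  | cons r rs ih =>
    cases rs' with
    | nil =>
      have := congrArg List.length heq
      simp [length_treeNode_word] at this
    | cons r' rs' =>
      simp only [treeNode, TreeState.step_word] at heq
      obtain ⟨h1, h2⟩ := List.append_inj' heq rfl
      obtain rfl := ih hrs.1 hrs'.1 h1
      have hF := treeNode_faithful hε hrs.1
      set s := treeNode ε rs with hs
      have hnodup : (0 :: (s.low ++ s.high)).Nodup := by
        rw [List.nodup_cons]
        exact ⟨fun h => by simpa using ((hF.mem_iff 0).1 h).1, hF.sorted.imp fun h => h.ne⟩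
      have hr : r < (0 :: (s.low ++ s.high)).length := by simpa [Nat.lt_succ_iff] using hrs.2
      have hr' : r' < (0 :: (s.low ++ s.high)).length := by simpa [Nat.lt_succ_iff] using hrs'.2
      rw [List.getD_eq_getElem _ _ hr, List.getD_eq_getElem _ _ hr', List.singleton_inj,
        hnodup.getElem_inj_iff] at h2
      rw [h2]

theorem exists_treeNode_word_eq {ε : ℕ} (hε : ε ≤ 1) {w : List ℕ} (hw : IsAscentSeq w)
    (ha : NonzeroAvoids ε w) : ∃ rs, ValidCode ε rs ∧ (treeNode ε rs).word = w := by
  induction w using List.reverseRecOn with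
  | nil => simp [IsAscentSeq] at hw
  | append_singleton u c ih =>
    rcases eq_or_ne u [] with rfl | hne
    · obtain rfl : c = 0 := by simpa [isAscentSeq_singleton] using hw
      exact ⟨[], trivial, rfl⟩
    rw [isAscentSeq_append u hne] at hw
    rw [nonzeroAvoids_append] at ha
    obtain ⟨rs, hrs, rfl⟩ := ih hw.1 ha.1
    have hF := treeNode_faithful hε hrs
    set s := treeNode ε rs with hs
    have hc : c ∈ 0 :: (s.low ++ s.high) := by
      rw [List.mem_cons, hF.mem_iff, hF.asc_eq]
      rcases Nat.eq_zero_or_pos c with h | h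
      · exact Or.inl h
      · exact Or.inr ⟨h, hw.2, ha.2⟩
    obtain ⟨r, hr, rfl⟩ := List.getElem_of_mem hc
    refine ⟨r :: rs, ⟨hrs, by simpa [Nat.lt_succ_iff] using hr⟩, ?_⟩
    rw [treeNode, TreeState.step_word, List.getD_eq_getElem _ _ hr]

theorem setOf_nonzeroAvoids_eq_image {ε : ℕ} (hε : ε ≤ 1) (n m : ℕ) :
    {w | w.length = n ∧ IsAscentSeq w ∧ numAscents w = m ∧ NonzeroAvoids ε w} =
      (fun rs => (treeNode ε rs).word) ''
        {rs | ValidCode ε rs ∧ rs.length + 1 = n ∧ (treeNode ε rs).asc = m} := by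
  ext w
  constructor
  · rintro ⟨hn, hw, hm, ha⟩
    obtain ⟨rs, hrs, rfl⟩ := exists_treeNode_word_eq hε hw ha
    exact ⟨rs, ⟨hrs, by rw [← hn, length_treeNode_word],
      by rw [(treeNode_faithful hε hrs).asc_eq, hm]⟩, rfl⟩
  · rintro ⟨rs, ⟨hrs, hn, hm⟩, rfl⟩
    have hF := treeNode_faithful hε hrs
    exact ⟨by rw [← hn, ← length_treeNode_word ε], hF.isAscentSeq, by rw [← hm, hF.asc_eq],
      hF.nonzeroAvoids⟩

/-- The data of two nodes that determine the shapes of the trees below them agree. -/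
def TreeState.SameShape (s t : TreeState) : Prop :=
  s.endsZero = t.endsZero ∧ s.low.length = t.low.length ∧ s.high.length = t.high.length ∧
    s.asc = t.asc

theorem TreeState.SameShape.step {s t : TreeState} (h : s.SameShape t) {r : ℕ}
    (hr : r ≤ s.low.length + s.high.length) : (s.step 0 r).SameShape (t.step 1 r) := by
  obtain ⟨h1, h2, h3, h4⟩ := h
  cases r with
  | zero => exact ⟨rfl, h2, h3, h4⟩
  | succ i =>
    refine ⟨rfl, by simp [TreeState.step, h2], ?_, by simp [TreeState.step, h1, h2, h4]⟩
    simp only [TreeState.step, List.length_append, List.length_drop, List.length_take, h1, h2, h3,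
      h4]
    omega

theorem validCode_iff_and_sameShape (rs : List ℕ) :
    (ValidCode 0 rs ↔ ValidCode 1 rs) ∧
      (ValidCode 0 rs → (treeNode 0 rs).SameShape (treeNode 1 rs)) := by
  induction rs with
  | nil => exact ⟨Iff.rfl, fun _ => ⟨rfl, rfl, rfl, rfl⟩⟩
  | cons r rs ih =>
    refine ⟨?_, fun h => (ih.2 h.1).step h.2⟩
    simp only [ValidCode, ← ih.1]
    refine and_congr_right fun h => ?_
    obtain ⟨-, h2, h3, -⟩ := ih.2 h
    rw [h2, h3]

theorem ncard_nonzeroAvoids_eq (n m : ℕ) :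
    {w | w.length = n ∧ IsAscentSeq w ∧ numAscents w = m ∧ NonzeroAvoids 0 w}.ncard =
      {w | w.length = n ∧ IsAscentSeq w ∧ numAscents w = m ∧ NonzeroAvoids 1 w}.ncard := by
  rw [setOf_nonzeroAvoids_eq_image zero_le_one, setOf_nonzeroAvoids_eq_image le_rfl,
    ((treeNode_word_injOn zero_le_one).mono fun _ h => h.1).ncard_image,
    ((treeNode_word_injOn le_rfl).mono fun _ h => h.1).ncard_image]
  congr 1
  ext rs
  have h := validCode_iff_and_sameShape rs
  simp only [Set.mem_ofPred_eq, ← h.1]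
  exact and_congr_right fun hv => by rw [(h.2 hv).2.2.2]

theorem avoiderCountAsc_congr {T T' : List (List ℕ)} (n m : ℕ)
    (h : ∀ w, IsAscentSeq w → ((∀ τ ∈ T, Avoids w τ) ↔ ∀ τ ∈ T', Avoids w τ)) :
    avoiderCountAsc n m T = avoiderCountAsc n m T' := by
  unfold avoiderCountAsc
  congr 1
  ext w
  refine and_congr_right fun _ => and_congr_right fun hw => and_congr_right fun _ => h w hw

theorem avoiderCountAsc_0121_0132 (n m : ℕ) : avoiderCountAsc n m [[0,1,2,1], [0,1,3,2]] =
    {w | w.length = n ∧ IsAscentSeq w ∧ numAscents w = m ∧ NonzeroAvoids 0 w}.ncard := by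
  unfold avoiderCountAsc
  congr 1
  ext w
  refine and_congr_right fun _ => and_congr_right fun hw => and_congr_right fun _ => ?_
  simpa using hw.avoids_0121_0132_iff

theorem avoiderCountAsc_0122_0132 (n m : ℕ) : avoiderCountAsc n m [[0,1,2,2], [0,1,3,2]] =
    {w | w.length = n ∧ IsAscentSeq w ∧ numAscents w = m ∧ NonzeroAvoids 1 w}.ncard := by
  unfold avoiderCountAsc
  congr 1
  ext w
  refine and_congr_right fun _ => and_congr_right fun hw => and_congr_right fun _ => ?_
  simpa using hw.avoids_0122_0132_iff

/-- `S_{n,m}(0121,0132) = S_{n,m}(0121,1032) = S_{n,m}(0122,0132) = S_{n,m}(0122,1032)`. -/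
theorem avoiderCountAsc_four_pairs_eq (n m : ℕ) (hn : 1 ≤ n) (hm : m < n) :
    avoiderCountAsc n m [[0,1,2,1], [0,1,3,2]] = avoiderCountAsc n m [[0,1,2,1], [1,0,3,2]] ∧
    avoiderCountAsc n m [[0,1,2,1], [1,0,3,2]] = avoiderCountAsc n m [[0,1,2,2], [0,1,3,2]] ∧
    avoiderCountAsc n m [[0,1,2,2], [0,1,3,2]] = avoiderCountAsc n m [[0,1,2,2], [1,0,3,2]] := by
  have h0121 : avoiderCountAsc n m [[0,1,2,1], [0,1,3,2]] =
      avoiderCountAsc n m [[0,1,2,1], [1,0,3,2]] := by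
    refine avoiderCountAsc_congr n m fun w hw => ?_
    have h1 := hw.contains_0132_of_contains_1032
    have h2 := hw.contains_of_contains_0132
    simp only [List.forall_mem_cons, List.not_mem_nil, Avoids]
    tauto
  have h0122 : avoiderCountAsc n m [[0,1,2,2], [0,1,3,2]] =
      avoiderCountAsc n m [[0,1,2,2], [1,0,3,2]] := by
    refine avoiderCountAsc_congr n m fun w hw => ?_
    have h1 := hw.contains_0132_of_contains_1032
    have h2 := hw.contains_of_contains_0132
    simp only [List.forall_mem_cons, List.not_mem_nil, Avoids]
    tauto
  refine ⟨h0121, ?_, h0122⟩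
  rw [← h0121, avoiderCountAsc_0121_0132, avoiderCountAsc_0122_0132, ncard_nonzeroAvoids_eq]
end

section
/- For n ≥ 1, the count a_{n,m,r,s} can be nonzero only when 0 ≤ s ≤ r ≤ m < n; moreover a_{n,0,0,0} = 1 for all n ≥ 1, a_{n,m,0,0} = 0 for all n, m ≥ 1, a_{n,m,1,1} = binom(n−1, 2m−1) for all n, m ≥ 1, a_{n,m,r,s} = 0 whenever r > s ≥ 1, and a_{2,1,1,0} = 0. -/
/-- `a_{n,m,r,s}`: the number of ascent sequences of length `n` avoiding the pattern 021
with exactly `m` ascents, largest letter `r`, and last letter `s`. -/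
noncomputable def aCount (n m r s : ℕ) : ℕ :=
  {w : List ℕ | w.length = n ∧ IsAscentSeq w ∧ Avoids w [0,2,1] ∧
    numAscents w = m ∧ w.foldr max 0 = r ∧ w.getLast? = some s}.ncard

theorem numAscents_cons_cons (a b : ℕ) (l : List ℕ) :
    numAscents (a :: b :: l) = numAscents (b :: l) + if a < b then 1 else 0 := by
  simp [numAscents, List.countP_cons]

theorem numAscents_append_pair (l : List ℕ) (y x : ℕ) :
    numAscents (l ++ [y, x]) = numAscents (l ++ [y]) + if y < x then 1 else 0 := by
  induction l with
  | nil => simp [numAscents]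
  | cons a l ih =>
    cases l with
    | nil => simp [numAscents, List.countP_cons, add_comm]
    | cons b l =>
      simp only [List.cons_append, numAscents_cons_cons] at ih ⊢
      omega

theorem numAscents_lt_length {w : List ℕ} (hw : w ≠ []) : numAscents w < w.length := by
  have h : numAscents w ≤ (w.zip w.tail).length := List.countP_le_length
  have := List.length_pos_iff.mpr hw
  simp only [List.length_zip, List.length_tail] at h
  omega

theorem foldr_max_le_iff {w : List ℕ} {k : ℕ} : w.foldr max 0 ≤ k ↔ ∀ x ∈ w, x ≤ k := by
  induction w with
  | nil => simp
  | cons a w ih => simp [ih]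

theorem foldr_max_mem {w : List ℕ} (h : w.foldr max 0 ≠ 0) : w.foldr max 0 ∈ w := by
  induction w with
  | nil => simp at h
  | cons a w ih =>
    simp only [List.foldr_cons] at h ⊢
    rcases le_total a (w.foldr max 0) with h' | h'
    · rw [max_eq_right h'] at h ⊢
      exact List.mem_cons_of_mem _ (ih h)
    · rw [max_eq_left h']
      exact List.mem_cons_self

theorem foldr_max_eq_zero {w : List ℕ} (h : w.foldr max 0 = 0) :
    w = List.replicate w.length 0 :=
  List.eq_replicate_iff.mpr ⟨rfl, fun x hx => Nat.le_zero.mp (foldr_max_le_iff.mp h.le x hx)⟩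

theorem IsAscentSeq.of_append_singleton {l : List ℕ} {x : ℕ} (hl : l ≠ [])
    (h : IsAscentSeq (l ++ [x])) : IsAscentSeq l ∧ x ≤ numAscents l + 1 := by
  obtain ⟨h0, h1⟩ := h
  have hpos := List.length_pos_iff.mpr hl
  refine ⟨⟨?_, fun i hi hi1 => ?_⟩, ?_⟩
  · rwa [List.head?_append_of_ne_nil _ hl] at h0
  · have := h1 i (by simp; omega) hi1
    simpa [List.getElem_append_left hi, List.take_append_of_le_length hi.le] using this
  · have := h1 l.length (by simp) hpos
    simpa using this

theorem IsAscentSeq.le_numAscents {w : List ℕ} (h : IsAscentSeq w) :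
    ∀ x ∈ w, x ≤ numAscents w := by
  induction w using List.reverseRecOn with
  | nil => simp
  | append_singleton l x ih =>
    rcases List.eq_nil_or_concat' l with rfl | ⟨l, y, rfl⟩
    · have := h.1
      simp_all
    · obtain ⟨hl, hx⟩ := h.of_append_singleton (by simp)
      have ih := ih hl
      have hy := ih y (by simp)
      have key := numAscents_append_pair l y x
      rw [List.append_assoc, List.singleton_append, key]
      intro z hz
      have hz' : z ∈ l ++ [y] ∨ z = x := by simpa [or_assoc] using hz
      rcases hz' with hz | rfl
      · have := ih z hz
        omega
      · split_ifs <;> omega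

theorem contains_021 {w : List ℕ} (i j k : Fin w.length) (hij : i < j) (hjk : j < k)
    (h₁ : w.get i < w.get k) (h₂ : w.get k < w.get j) : Contains w [0, 2, 1] := by
  refine ⟨![i, j, k], ?_, ?_⟩
  · intro a b hab
    fin_cases a <;> fin_cases b <;> simp_all
    exact hij.trans hjk
  · intro a b
    fin_cases a <;> fin_cases b <;> simp at h₁ h₂ ⊢ <;> omega

theorem avoids_021_of_le_one {w : List ℕ} (hw : ∀ x ∈ w, x ≤ 1) : Avoids w [0, 2, 1] := by
  rintro ⟨f, -, hf⟩
  have h₁ := (hf 0 2).1.mpr (by simp)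
  have h₂ := (hf 2 1).1.mpr (by simp)
  have := hw _ (List.get_mem w (f 1))
  omega

theorem contains_021_of_getLast_lt_max {w : List ℕ} {s : ℕ} (h0 : w.head? = some 0)
    (hs : 1 ≤ s) (hlast : w.getLast? = some s) (hlt : s < w.foldr max 0) :
    Contains w [0, 2, 1] := by
  obtain ⟨j, hj⟩ := List.get_of_mem (foldr_max_mem (w := w) (by omega))
  have hpos : 0 < w.length := j.pos
  have hfirst : w.get ⟨0, hpos⟩ = 0 := by
    simpa [List.head?_eq_getElem?, List.getElem?_eq_getElem hpos] using h0
  have hl : w.get ⟨w.length - 1, by omega⟩ = s := by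
    rw [List.getLast?_eq_getElem?, List.getElem?_eq_getElem (by omega)] at hlast
    simpa using hlast
  refine contains_021 ⟨0, hpos⟩ j ⟨w.length - 1, by omega⟩ ?_ ?_ (by omega) (by omega)
  · rw [Fin.lt_def, Nat.pos_iff_ne_zero]
    intro h
    have : j = ⟨0, hpos⟩ := Fin.ext h
    subst this
    omega
  · have hne : j.val ≠ w.length - 1 := by
      intro h
      rw [show j = ⟨w.length - 1, by omega⟩ from Fin.ext h] at hj
      omega
    have := j.isLt
    rw [Fin.lt_def]
    change j.val < w.length - 1
    omega

/-- Words of length `n` over `{0, 1}` with first letter `a`, last letter `1` and `m` ascents. -/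
def binaryWords (n a m : ℕ) : Set (List ℕ) :=
  {w | w.length = n ∧ (∀ x ∈ w, x ≤ 1) ∧ w.head? = some a ∧ numAscents w = m ∧
    w.getLast? = some 1}

theorem binaryWords_add_two (n a m : ℕ) (ha : a ≤ 1) :
    binaryWords (n + 2) a m =
      List.cons a '' (binaryWords (n + 1) a m ∪
        {w ∈ binaryWords (n + 1) (1 - a) (m - (1 - a)) | 1 - a ≤ m}) := by
  ext w
  constructor
  · rintro ⟨hlen, hle, hhead, hasc, hlast⟩
    match w, hlen with
    | x :: y :: l, hlen =>
      obtain rfl : x = a := by simpa using hhead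
      have hy : y ≤ 1 := hle y (by simp)
      rw [numAscents_cons_cons] at hasc
      refine ⟨y :: l, ?_, rfl⟩
      have hlen' : (y :: l).length = n + 1 := by simpa using hlen
      have hle' : ∀ z ∈ y :: l, z ≤ 1 := fun z hz => hle z (List.mem_cons_of_mem _ hz)
      have hlast' : (y :: l).getLast? = some 1 := by simpa using hlast
      by_cases hxy : y = x
      · left
        refine ⟨hlen', hle', by simp [hxy], ?_, hlast'⟩
        rw [if_neg (by omega)] at hasc
        omega
      · right
        refine ⟨⟨hlen', hle', ?_, ?_, hlast'⟩, ?_⟩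
        · simp; omega
        · split_ifs at hasc <;> omega
        · split_ifs at hasc <;> omega
  · rintro ⟨v, ⟨hlen, hle, hhead, hasc, hlast⟩ | ⟨⟨hlen, hle, hhead, hasc, hlast⟩, hm⟩, rfl⟩
    all_goals
      match v, hlen with
      | y :: l, hlen =>
        simp only [List.head?_cons, Option.some.injEq] at hhead
        refine ⟨by simpa using hlen, List.forall_mem_cons.mpr ⟨ha, hle⟩, rfl, ?_,
          by simpa using hlast⟩
        rw [numAscents_cons_cons]
        split_ifs <;> omega

theorem encard_binaryWords (n m : ℕ) :
    (binaryWords (n + 1) 0 m).encard = (if m = 0 then 0 else n.choose (2 * m - 1) : ℕ) ∧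
      (binaryWords (n + 1) 1 m).encard = (n.choose (2 * m) : ℕ) := by
  induction n generalizing m with
  | zero =>
    constructor
    · have : binaryWords (0 + 1) 0 m = ∅ := by
        ext w
        simp only [binaryWords, Set.mem_ofPred_eq, Set.mem_empty_iff_false, iff_false]
        rintro ⟨hlen, -, hhead, -, hlast⟩
        obtain ⟨x, rfl⟩ := List.length_eq_one_iff.mp hlen
        simp_all
      rw [this]
      rcases m with _ | m
      · simp
      · simp [Nat.choose_eq_zero_of_lt (show 0 < 2 * (m + 1) - 1 by omega)]
    · rcases m with _ | m
      · have : binaryWords (0 + 1) 1 0 = {[1]} := by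
          ext w
          simp only [binaryWords, Set.mem_ofPred_eq, Set.mem_singleton_iff]
          constructor
          · rintro ⟨hlen, -, hhead, -, -⟩
            obtain ⟨x, rfl⟩ := List.length_eq_one_iff.mp hlen
            simp_all
          · rintro rfl
            simp [numAscents]
        simp [this]
      · have : binaryWords (0 + 1) 1 (m + 1) = ∅ := by
          ext w
          simp only [binaryWords, Set.mem_ofPred_eq, Set.mem_empty_iff_false, iff_false]
          rintro ⟨hlen, -, -, hasc, -⟩
          obtain ⟨x, rfl⟩ := List.length_eq_one_iff.mp hlen
          simp [numAscents] at hasc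
        rw [this]
        simp [Nat.choose_eq_zero_of_lt (show 0 < 2 * (m + 1) by omega)]
  | succ n ih =>
    have hdisj : ∀ a b k l : ℕ, a ≠ b → ∀ p : List ℕ → Prop,
        Disjoint (binaryWords (n + 1) a k) {w ∈ binaryWords (n + 1) b l | p w} := by
      intro a b k l hab p
      rw [Set.disjoint_left]
      rintro w ⟨-, -, h, -⟩ ⟨⟨-, -, h', -⟩, -⟩
      exact hab (by simpa [h] using h')
    have hinj : ∀ a : ℕ, Function.Injective (List.cons a) := fun a => List.cons_injective
    constructor
    · rw [binaryWords_add_two n 0 m (by omega), (hinj 0).encard_image,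
        Set.encard_union_eq (hdisj _ _ _ _ (by omega) _), (ih m).1]
      rcases m with _ | m
      · simp
      · simp only [Nat.sub_zero, Nat.add_sub_cancel, Nat.le_add_left, and_true, Set.ofPred_mem_eq,
          (ih m).2]
        rw [if_neg (by omega), if_neg (by omega), ← Nat.cast_add,
          show 2 * (m + 1) - 1 = 2 * m + 1 by omega, Nat.choose_succ_succ, add_comm]
    · rw [binaryWords_add_two n 1 m (by omega), (hinj 1).encard_image,
        Set.encard_union_eq (hdisj _ _ _ _ (by omega) _), (ih m).2]
      simp only [Nat.sub_self, Nat.sub_zero, Nat.zero_le, and_true, Set.ofPred_mem_eq, (ih m).1]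
      rw [← Nat.cast_add]
      rcases m with _ | m
      · simp
      · rw [if_neg (by omega), show 2 * (m + 1) - 1 = 2 * m + 1 by omega,
          show 2 * (m + 1) = 2 * m + 1 + 1 by omega, Nat.choose_succ_succ n (2 * m + 1), add_comm]

theorem aCount_one_one_eq_ncard (n m : ℕ) :
    aCount n m 1 1 = (binaryWords n 0 m).ncard := by
  unfold aCount binaryWords
  congr 1
  ext w
  constructor
  · rintro ⟨hlen, hw, -, hasc, hmax, hlast⟩
    exact ⟨hlen, foldr_max_le_iff.mp hmax.le, hw.1, hasc, hlast⟩
  · rintro ⟨hlen, hle, hhead, hasc, hlast⟩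
    refine ⟨hlen, ⟨hhead, fun i hi _ => ?_⟩, avoids_021_of_le_one hle, hasc, ?_, hlast⟩
    · have := hle _ (List.get_mem w ⟨i, hi⟩)
      omega
    · exact le_antisymm (foldr_max_le_iff.mpr hle)
        (foldr_max_le_iff.mp le_rfl 1 (List.mem_of_getLast? hlast))

theorem aCount_zero_zero_zero {n : ℕ} (hn : 1 ≤ n) : aCount n 0 0 0 = 1 := by
  rw [aCount, Set.ncard_eq_one]
  refine ⟨List.replicate n 0, ?_⟩
  ext w
  constructor
  · rintro ⟨rfl, -, -, -, hmax, -⟩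
    exact foldr_max_eq_zero hmax
  · rintro rfl
    have hle : ∀ x ∈ List.replicate n 0, x ≤ 0 := fun x hx => (List.eq_of_mem_replicate hx).le
    refine ⟨by simp, ⟨?_, fun i hi _ => by simp⟩,
      avoids_021_of_le_one fun x hx => (hle x hx).trans zero_le_one, numAscents_replicate n 0,
      Nat.le_zero.mp (foldr_max_le_iff.mpr hle), ?_⟩
    · simp [List.head?_replicate]; omega
    · simp [List.getLast?_replicate]; omega

theorem aCount_eq_zero {n m r s : ℕ}
    (h : ∀ w : List ℕ, w.length = n → IsAscentSeq w → Avoids w [0, 2, 1] → numAscents w = m →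
      w.foldr max 0 = r → w.getLast? = some s → False) : aCount n m r s = 0 := by
  have : {w : List ℕ | w.length = n ∧ IsAscentSeq w ∧ Avoids w [0, 2, 1] ∧
      numAscents w = m ∧ w.foldr max 0 = r ∧ w.getLast? = some s} = ∅ :=
    Set.eq_empty_iff_forall_notMem.mpr fun w ⟨h₁, h₂, h₃, h₄, h₅, h₆⟩ => h w h₁ h₂ h₃ h₄ h₅ h₆
  rw [aCount, this, Set.ncard_empty]

/-- Basic facts about the array `a_{n,m,r,s}`. -/
theorem aCount_basic :
    (∀ n m r s : ℕ, 1 ≤ n → aCount n m r s ≠ 0 → s ≤ r ∧ r ≤ m ∧ m < n) ∧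
    (∀ n : ℕ, 1 ≤ n → aCount n 0 0 0 = 1) ∧
    (∀ n m : ℕ, 1 ≤ n → 1 ≤ m → aCount n m 0 0 = 0) ∧
    (∀ n m : ℕ, 1 ≤ n → 1 ≤ m → aCount n m 1 1 = (n - 1).choose (2 * m - 1)) ∧
    (∀ n m r s : ℕ, 1 ≤ s → s < r → aCount n m r s = 0) ∧
    aCount 2 1 1 0 = 0 := by
  refine ⟨fun n m r s hn h => ?_, fun n hn => aCount_zero_zero_zero hn, fun n m hn hm => ?_,
    fun n m hn hm => ?_, fun n m r s hs hr => ?_, ?_⟩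
  · obtain ⟨w, rfl, hw, -, rfl, rfl, hlast⟩ := Set.nonempty_of_ncard_ne_zero h
    exact ⟨foldr_max_le_iff.mp le_rfl s (List.mem_of_getLast? hlast),
      foldr_max_le_iff.mpr hw.le_numAscents,
      numAscents_lt_length (List.length_pos_iff.mp hn)⟩
  · refine aCount_eq_zero fun w _ _ _ hasc hmax _ => ?_
    rw [foldr_max_eq_zero hmax, numAscents_replicate] at hasc
    omega
  · obtain ⟨n, rfl⟩ := Nat.exists_eq_add_of_le' hn
    rw [aCount_one_one_eq_ncard, Set.ncard, (encard_binaryWords n m).1, if_neg (by omega)]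
    simp
  · refine aCount_eq_zero fun w _ hw hav _ hmax hlast => ?_
    exact hav (contains_021_of_getLast_lt_max hw.1 hs hlast (by omega))
  · refine aCount_eq_zero fun w hlen hw _ _ hmax hlast => ?_
    obtain ⟨a, b, rfl⟩ := List.length_eq_two.mp hlen
    have := hw.1
    simp_all
end
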